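/- arXiv:2601.01447 — 2 statements merged into one kernel-verified Lean document; each statement's English description precedes it below -/
import Mathlib

section
/- Let α > 0, γ ∈ ℝ, u₀ > 0, M(u) := u^γ e^{α/u}, let H : [0,u₀] → ℝ be continuous, let c₀ ∈ ℝ, and set f(u) := (M(u₀)/M(u)) c₀ + (1/M(u)) ∫_u^{u₀} t^{γ−2} e^{α/t} H(t) dt and K(u,y) := (μ/M(u)) ∫_u^y t^{γ−2} e^{α/t} F̄(y−t) dt for 0 < u ≤ y ≤ u₀. Suppose g : (0,u₀] → ℝ is continuous and bounded and satisfies the Volterra equation g(u) = f(u) + ∫_u^{u₀} K(u,y) g(y) dy for all u ∈ (0,u₀]. Then the limit g(0+) := lim_{u↓0} g(u) exists and equals H(0)/α + (μ/α) ∫₀^{u₀} g(y) F̄(y−) dy, where F̄(y−) denotes the left limit of F̄ at y. -/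
open MeasureTheory Set Filter Topology Function

theorem tendsto_rpow_mul_exp_div_atTop {α : ℝ} (γ : ℝ) (hα : 0 < α) :
    Tendsto (fun u : ℝ => u ^ γ * Real.exp (α / u)) (𝓝[>] 0) atTop := by
  refine ((tendsto_exp_mul_div_rpow_atTop γ α hα).comp tendsto_inv_nhdsGT_zero).congr' ?_
  filter_upwards [self_mem_nhdsWithin] with u hu
  have hu : 0 < u := hu
  simp only [comp_apply, Real.inv_rpow hu.le, div_eq_mul_inv, inv_inv]
  ring

theorem continuousOn_rpow_mul_exp_div (γ α : ℝ) :
    ContinuousOn (fun t : ℝ => t ^ γ * Real.exp (α / t)) (Ioi 0) := fun t ht =>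
  ((Real.continuousAt_rpow_const t γ (Or.inl (ne_of_gt ht))).mul
    (Real.continuous_exp.continuousAt.comp
      (continuousAt_const.div continuousAt_id (ne_of_gt ht)))).continuousWithinAt

theorem intervalIntegrable_rpow_mul_exp_div (γ α : ℝ) {a b : ℝ} (ha : 0 < a) (hb : 0 < b) :
    IntervalIntegrable (fun t : ℝ => t ^ γ * Real.exp (α / t)) volume a b :=
  ((continuousOn_rpow_mul_exp_div γ α).mono fun _ ht =>
    (lt_min ha hb).trans_le ht.1).intervalIntegrable

theorem hasDerivAt_rpow_mul_exp_div (γ α : ℝ) {t : ℝ} (ht : 0 < t) :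
    HasDerivAt (fun t : ℝ => t ^ γ * Real.exp (α / t))
      (-(t ^ (γ - 2) * Real.exp (α / t) * (α - γ * t))) t := by
  have h1 := Real.hasDerivAt_rpow_const (p := γ) (Or.inl ht.ne')
  have h2 := ((hasDerivAt_inv ht.ne').const_mul α).exp
  simp only [← div_eq_mul_inv] at h2
  refine (h1.mul h2).congr_deriv ?_
  have e1 : t ^ (γ - 1) = t ^ (γ - 2) * t := by
    rw [← Real.rpow_add_one ht.ne']; congr 1; ring
  have e2 : t ^ γ = t ^ (γ - 2) * t ^ 2 := by
    rw [← Real.rpow_natCast, ← Real.rpow_add ht]; congr 1; push_cast; ring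
  rw [e1, e2]
  field_simp
  ring

theorem intervalIntegrable_rpow_mul_exp_div_mul_sub (γ α : ℝ) {a b : ℝ} (ha : 0 < a)
    (hb : 0 < b) :
    IntervalIntegrable (fun t : ℝ => t ^ (γ - 2) * Real.exp (α / t) * (α - γ * t))
      volume a b :=
  (intervalIntegrable_rpow_mul_exp_div (γ - 2) α ha hb).mul_continuousOn (by fun_prop)

theorem integral_rpow_mul_exp_div_mul_sub (γ α : ℝ) {a b : ℝ} (ha : 0 < a) (hb : 0 < b) :
    ∫ t in a..b, t ^ (γ - 2) * Real.exp (α / t) * (α - γ * t) =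
      a ^ γ * Real.exp (α / a) - b ^ γ * Real.exp (α / b) := by
  have h := intervalIntegral.integral_eq_sub_of_hasDerivAt
    (fun t ht => hasDerivAt_rpow_mul_exp_div γ α ((lt_min ha hb).trans_le ht.1))
    (intervalIntegrable_rpow_mul_exp_div_mul_sub γ α ha hb).neg
  simp only [intervalIntegral.integral_neg] at h
  linarith

/-- Weighted averages of a function vanishing at `0+` tend to zero. -/
theorem tendsto_inv_mul_integral_zero {α γ b : ℝ} (hα : 0 < α) (hb : 0 < b) {ρ : ℝ → ℝ}
    (hρ : Tendsto ρ (𝓝[>] 0) (𝓝 0))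
    (hint : ∀ u ∈ Ioc 0 b,
      IntervalIntegrable (fun t => t ^ (γ - 2) * Real.exp (α / t) * ρ t) volume u b) :
    Tendsto (fun u : ℝ => (u ^ γ * Real.exp (α / u))⁻¹ *
      ∫ t in u..b, t ^ (γ - 2) * Real.exp (α / t) * ρ t) (𝓝[>] 0) (𝓝 0) := by
  rw [Metric.tendsto_nhds]
  intro ε hε
  have hη : 0 < ε * α / 4 := by positivity
  have hlin : Tendsto (fun t : ℝ => γ * t) (𝓝[>] 0) (𝓝 0) := by
    have : Tendsto (fun t : ℝ => γ * t) (𝓝 0) (𝓝 (γ * 0)) :=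
      (continuous_const.mul continuous_id).tendsto 0
    rw [mul_zero] at this
    exact this.mono_left nhdsWithin_le_nhds
  have hev := ((Metric.tendsto_nhds.1 hρ) _ hη).and (hlin.eventually_le_const (half_pos hα))
  obtain ⟨δ₀, hδ₀, hδ₀'⟩ := mem_nhdsGT_iff_exists_Ioc_subset.1 hev
  have hδ₀ : 0 < δ₀ := hδ₀
  obtain ⟨δ, hδ, hδb, hδδ₀⟩ : ∃ δ, 0 < δ ∧ δ ≤ b ∧ δ ≤ δ₀ :=
    ⟨min δ₀ b, lt_min hδ₀ hb, min_le_right _ _, min_le_left _ _⟩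
  set C := |∫ t in δ..b, t ^ (γ - 2) * Real.exp (α / t) * ρ t| with hC
  filter_upwards [Ioc_mem_nhdsGT hδ,
    (tendsto_rpow_mul_exp_div_atTop γ hα).eventually_gt_atTop (2 * C / ε)] with u hu hMu
  have hM : 0 < u ^ γ * Real.exp (α / u) := mul_pos (Real.rpow_pos_of_pos hu.1 _) (Real.exp_pos _)
  have hMδ : 0 < δ ^ γ * Real.exp (α / δ) := mul_pos (Real.rpow_pos_of_pos hδ _) (Real.exp_pos _)
  have hsplit := intervalIntegral.integral_add_adjacent_intervals
    ((hint u ⟨hu.1, hu.2.trans hδb⟩).trans (hint δ ⟨hδ, hδb⟩).symm) (hint δ ⟨hδ, hδb⟩)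
  have hnear : |∫ t in u..δ, t ^ (γ - 2) * Real.exp (α / t) * ρ t| ≤
      ε / 2 * (u ^ γ * Real.exp (α / u) - δ ^ γ * Real.exp (α / δ)) := by
    rw [← integral_rpow_mul_exp_div_mul_sub γ α hu.1 hδ, ← intervalIntegral.integral_const_mul,
      ← Real.norm_eq_abs]
    refine intervalIntegral.norm_integral_le_of_norm_le hu.2 (ae_of_all _ fun t ht => ?_)
      ((intervalIntegrable_rpow_mul_exp_div_mul_sub γ α hu.1 hδ).const_mul _)
    have ht0 : 0 < t := hu.1.trans ht.1
    obtain ⟨h1, h2⟩ := hδ₀' ⟨ht0, ht.2.trans hδδ₀⟩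
    have hw : 0 < t ^ (γ - 2) * Real.exp (α / t) :=
      mul_pos (Real.rpow_pos_of_pos ht0 _) (Real.exp_pos _)
    rw [Real.dist_eq, sub_zero] at h1
    rw [Real.norm_eq_abs, abs_mul, abs_of_pos hw, mul_left_comm]
    refine mul_le_mul_of_nonneg_left ?_ hw.le
    nlinarith
  rw [Real.dist_eq, sub_zero, abs_mul, abs_of_pos (inv_pos.2 hM), inv_mul_lt_iff₀ hM, ← hsplit]
  have h2C : 2 * C < u ^ γ * Real.exp (α / u) * ε := (div_lt_iff₀ hε).1 hMu
  have := abs_add_le (∫ t in u..δ, t ^ (γ - 2) * Real.exp (α / t) * ρ t)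
    (∫ t in δ..b, t ^ (γ - 2) * Real.exp (α / t) * ρ t)
  have := mul_pos (half_pos hε) hMδ
  linarith

/-- Weighted averages of a function with limit `L` at `0+` tend to `L / α`. -/
theorem tendsto_inv_mul_integral {α γ b L : ℝ} (hα : 0 < α) (hb : 0 < b) {φ : ℝ → ℝ}
    (hφ : Tendsto φ (𝓝[>] 0) (𝓝 L))
    (hint : ∀ u ∈ Ioc 0 b,
      IntervalIntegrable (fun t => t ^ (γ - 2) * Real.exp (α / t) * φ t) volume u b) :
    Tendsto (fun u : ℝ => (u ^ γ * Real.exp (α / u))⁻¹ *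
      ∫ t in u..b, t ^ (γ - 2) * Real.exp (α / t) * φ t) (𝓝[>] 0) (𝓝 (L / α)) := by
  have hid : Tendsto (fun t : ℝ => L / α * (α - γ * t)) (𝓝[>] 0) (𝓝 L) := by
    have : Tendsto (fun t : ℝ => L / α * (α - γ * t)) (𝓝 0) (𝓝 (L / α * (α - γ * 0))) :=
      (by fun_prop : Continuous fun t : ℝ => L / α * (α - γ * t)).tendsto 0
    rw [mul_zero, sub_zero, div_mul_cancel₀ _ hα.ne'] at this
    exact this.mono_left nhdsWithin_le_nhds
  have hρ : Tendsto (fun t => φ t - L / α * (α - γ * t)) (𝓝[>] 0) (𝓝 0) := by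
    simpa using hφ.sub hid
  have hw (u : ℝ) (hu : u ∈ Ioc 0 b) :=
    (intervalIntegrable_rpow_mul_exp_div_mul_sub γ α hu.1 hb).const_mul (L / α)
  have hexp (t : ℝ) : t ^ (γ - 2) * Real.exp (α / t) * (φ t - L / α * (α - γ * t)) =
      t ^ (γ - 2) * Real.exp (α / t) * φ t -
        L / α * (t ^ (γ - 2) * Real.exp (α / t) * (α - γ * t)) := by ring
  have h0 := tendsto_inv_mul_integral_zero (γ := γ) hα hb hρ
    fun u hu => by simpa only [hexp] using (hint u hu).sub (hw u hu)
  have hM := (tendsto_rpow_mul_exp_div_atTop γ hα).inv_tendsto_atTop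
  have h1 := h0.add ((hM.mul_const (b ^ γ * Real.exp (α / b))).const_sub 1 |>.const_mul (L / α))
  simp only [zero_mul, sub_zero, mul_one, zero_add] at h1
  refine h1.congr' ?_
  filter_upwards [Ioc_mem_nhdsGT hb] with u hu
  have hMu : 0 < u ^ γ * Real.exp (α / u) :=
    mul_pos (Real.rpow_pos_of_pos hu.1 _) (Real.exp_pos _)
  simp only [hexp, Pi.inv_apply]
  rw [intervalIntegral.integral_sub (hint u hu) (hw u hu), intervalIntegral.integral_const_mul,
    integral_rpow_mul_exp_div_mul_sub γ α hu.1 hb]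
  generalize u ^ γ * Real.exp (α / u) = Mu at hMu ⊢
  field_simp
  ring

theorem AntitoneOn.antitone_comp_max_zero {F : ℝ → ℝ} (hF : AntitoneOn F (Ici 0)) :
    Antitone fun z => F (max z 0) := fun _ _ hab =>
  hF (mem_Ici.2 (le_max_right _ _)) (mem_Ici.2 (le_max_right _ _)) (max_le_max_right _ hab)

theorem AntitoneOn.tendsto_leftLim_of_pos {F : ℝ → ℝ} (hF : AntitoneOn F (Ici 0))
    {y : ℝ} (hy : 0 < y) :
    Tendsto F (𝓝[<] y) (𝓝 (leftLim F y)) := by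
  have heq : (fun z => F (max z 0)) =ᶠ[𝓝[<] y] F := by
    filter_upwards [Ioo_mem_nhdsLT hy] with z hz
    rw [max_eq_left hz.1.le]
  exact tendsto_leftLim_of_tendsto
    ⟨_, (hF.antitone_comp_max_zero.tendsto_leftLim y).congr' heq⟩

theorem stmt13
    (Fbar : ℝ → ℝ) (μ α γ m : ℝ)
    (hμ : 0 < μ) (hα : 0 < α)
    (hF_anti : AntitoneOn Fbar (Set.Ici 0))
    (hF_mem : ∀ y ∈ Set.Ici (0 : ℝ), Fbar y ∈ Set.Icc (0 : ℝ) 1)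
    (hF_int : IntegrableOn Fbar (Set.Ioi 0))
    (hm : m = ∫ z in Set.Ioi (0 : ℝ), Fbar z)
    (u₀ : ℝ) (hu₀ : 0 < u₀)
    (H : ℝ → ℝ) (hH : ContinuousOn H (Set.Icc 0 u₀)) (c₀ : ℝ)
    (g : ℝ → ℝ)
    (hgc : ContinuousOn g (Set.Ioc 0 u₀))
    (hgbdd : ∃ B : ℝ, ∀ u ∈ Set.Ioc (0 : ℝ) u₀, |g u| ≤ B)
    (hVolterra : ∀ u ∈ Set.Ioc (0 : ℝ) u₀,
      g u = ((u₀ ^ γ * Real.exp (α / u₀)) / (u ^ γ * Real.exp (α / u)) * c₀ +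
          (u ^ γ * Real.exp (α / u))⁻¹ *
            ∫ t in u..u₀, t ^ (γ - 2) * Real.exp (α / t) * H t) +
        ∫ y in u..u₀,
          (μ / (u ^ γ * Real.exp (α / u)) *
            ∫ t in u..y, t ^ (γ - 2) * Real.exp (α / t) * Fbar (y - t)) * g y) :
    Tendsto g (nhdsWithin 0 (Set.Ioi 0))
      (nhds (H 0 / α + μ / α * ∫ y in (0 : ℝ)..u₀, g y * leftLim Fbar y)) := by
  obtain ⟨B, hB⟩ := hgbdd
  have hanti := hF_anti.antitone_comp_max_zero
  have hMpos (u : ℝ) (hu : 0 < u) : 0 < u ^ γ * Real.exp (α / u) :=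
    mul_pos (Real.rpow_pos_of_pos hu _) (Real.exp_pos _)
  have hwpos (u : ℝ) (hu : 0 < u) : 0 < u ^ (γ - 2) * Real.exp (α / u) :=
    mul_pos (Real.rpow_pos_of_pos hu _) (Real.exp_pos _)
  have hbd : Tendsto (fun u : ℝ => (u₀ ^ γ * Real.exp (α / u₀)) / (u ^ γ * Real.exp (α / u)) * c₀)
      (𝓝[>] 0) (𝓝 0) := by
    have := ((tendsto_rpow_mul_exp_div_atTop γ hα).const_div_atTop
      (u₀ ^ γ * Real.exp (α / u₀))).mul_const c₀
    rwa [zero_mul] at this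
  have hHlim : Tendsto (fun u : ℝ => (u ^ γ * Real.exp (α / u))⁻¹ *
      ∫ t in u..u₀, t ^ (γ - 2) * Real.exp (α / t) * H t) (𝓝[>] 0) (𝓝 (H 0 / α)) := by
    refine tendsto_inv_mul_integral hα hu₀ ?_ fun u hu => ?_
    · exact ((hH 0 (left_mem_Icc.2 hu₀.le)).mono_of_mem_nhdsWithin (Icc_mem_nhdsGT hu₀)).tendsto
    · refine (intervalIntegrable_rpow_mul_exp_div (γ - 2) α hu.1 hu₀).mul_continuousOn
        (hH.mono ?_)
      rw [uIcc_of_le hu.2]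
      exact Icc_subset_Icc_left hu.1.le
  have hFint (u y : ℝ) (hu : 0 < u) (hy : u ≤ y) :
      IntervalIntegrable (fun t => t ^ (γ - 2) * Real.exp (α / t) * Fbar (y - t)) volume u y := by
    have h1 := intervalIntegrable_rpow_mul_exp_div (γ - 2) α hu (hu.trans_le hy)
    rw [intervalIntegrable_iff_integrableOn_Ioc_of_le hy] at h1 ⊢
    refine IntegrableOn.congr_fun (f := fun t =>
      t ^ (γ - 2) * Real.exp (α / t) * Fbar (max (y - t) 0)) ?_ (fun t ht => ?_) measurableSet_Ioc
    · refine Integrable.mul_bdd (c := 1) h1 ?_ (ae_of_all _ fun t => ?_)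
      · exact (hanti.measurable.comp (measurable_const.sub measurable_id)).aestronglyMeasurable
      · have := hF_mem (max (y - t) 0) (mem_Ici.2 (le_max_right _ _))
        rw [Real.norm_eq_abs, abs_of_nonneg this.1]
        exact this.2
    · simp only [max_eq_left (sub_nonneg.2 ht.2)]
  have hKlim (y : ℝ) (hy : 0 < y) : Tendsto (fun u : ℝ => (u ^ γ * Real.exp (α / u))⁻¹ *
      ∫ t in u..y, t ^ (γ - 2) * Real.exp (α / t) * Fbar (y - t)) (𝓝[>] 0)
      (𝓝 (leftLim Fbar y / α)) := by
    refine tendsto_inv_mul_integral hα hy ?_ fun u hu => hFint u y hu.1 hu.2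
    refine (hF_anti.tendsto_leftLim_of_pos hy).comp ?_
    refine tendsto_nhdsWithin_iff.2 ⟨?_, ?_⟩
    · have : Tendsto (fun t : ℝ => y - t) (𝓝 0) (𝓝 (y - 0)) :=
        (continuous_const.sub continuous_id).tendsto 0
      rw [sub_zero] at this
      exact this.mono_left nhdsWithin_le_nhds
    · filter_upwards [self_mem_nhdsWithin] with t ht
      exact sub_lt_self y ht
  have hone : Tendsto (fun u : ℝ => (u ^ γ * Real.exp (α / u))⁻¹ *
      ∫ t in u..u₀, t ^ (γ - 2) * Real.exp (α / t)) (𝓝[>] 0) (𝓝 (1 / α)) := by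
    simpa only [mul_one] using tendsto_inv_mul_integral (γ := γ) (φ := fun _ => 1) hα hu₀
      tendsto_const_nhds fun u hu => by
        simpa only [mul_one] using intervalIntegrable_rpow_mul_exp_div (γ - 2) α hu.1 hu₀
  have hKlim' : Tendsto (fun u : ℝ => ∫ y in Ioc 0 u₀, (Ioc u u₀).indicator (fun y =>
      (μ / (u ^ γ * Real.exp (α / u)) *
        ∫ t in u..y, t ^ (γ - 2) * Real.exp (α / t) * Fbar (y - t)) * g y) y) (𝓝[>] 0)
      (𝓝 (∫ y in Ioc 0 u₀, μ / α * (g y * leftLim Fbar y))) := by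
    refine tendsto_integral_filter_of_dominated_convergence (fun _ => μ * (1 / α + 1) * B)
      ?_ ?_ ?_ ?_
    · filter_upwards [Ioc_mem_nhdsGT hu₀] with u hu
      refine (aestronglyMeasurable_indicator_iff measurableSet_Ioc).2 ?_
      rw [Measure.restrict_restrict measurableSet_Ioc,
        inter_eq_self_of_subset_left (Ioc_subset_Ioc_left hu.1.le)]
      refine AEStronglyMeasurable.mul (AEStronglyMeasurable.const_mul ?_ _)
        ((hgc.mono (Ioc_subset_Ioc_left hu.1.le)).aestronglyMeasurable measurableSet_Ioc)
      have hmeas : StronglyMeasurable fun p : ℝ × ℝ => {p : ℝ × ℝ | p.2 ≤ p.1}.indicator (fun p =>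
          p.2 ^ (γ - 2) * Real.exp (α / p.2) * Fbar (max (p.1 - p.2) 0)) p := by
        refine Measurable.stronglyMeasurable (Measurable.indicator ?_
          (measurableSet_le measurable_snd measurable_fst))
        exact ((measurable_snd.pow_const _).mul
          (Real.measurable_exp.comp (measurable_const.div measurable_snd))).mul
          (hanti.measurable.comp (measurable_fst.sub measurable_snd))
      refine AEStronglyMeasurable.congr (hmeas.integral_prod_right'
        (ν := volume.restrict (Ioc u u₀))).aestronglyMeasurable ?_
      filter_upwards [ae_restrict_mem measurableSet_Ioc] with y hy
      rw [intervalIntegral.integral_of_le hy.1.le]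
      have hset : Ioc u y = Iic y ∩ Ioc u u₀ := by
        ext t
        simp only [mem_Ioc, mem_inter_iff, mem_Iic]
        exact ⟨fun h => ⟨h.2, h.1, h.2.trans hy.2⟩, fun h => ⟨h.2.1, h.1⟩⟩
      have hind : (fun t => {p : ℝ × ℝ | p.2 ≤ p.1}.indicator (fun p =>
          p.2 ^ (γ - 2) * Real.exp (α / p.2) * Fbar (max (p.1 - p.2) 0)) (y, t)) =
          (Iic y).indicator fun t => t ^ (γ - 2) * Real.exp (α / t) * Fbar (y - t) := by
        ext t
        by_cases ht : t ≤ y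
        · simp [indicator, ht]
        · simp [indicator, ht]
      rw [hind, integral_indicator measurableSet_Iic,
        Measure.restrict_restrict measurableSet_Iic, hset]
    · filter_upwards [Ioc_mem_nhdsGT hu₀,
        hone.eventually_le_const (lt_add_one (1 / α))] with u hu hle
      filter_upwards [ae_restrict_mem measurableSet_Ioc] with y hy
      have hB0 : 0 ≤ B := (abs_nonneg _).trans (hB y hy)
      have hinv := inv_pos.2 (hMpos u hu.1)
      by_cases hyu : y ∈ Ioc u u₀
      · rw [indicator_of_mem hyu, Real.norm_eq_abs, abs_mul]
        refine mul_le_mul ?_ (hB y hy) (abs_nonneg _) (by positivity)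
        rw [div_eq_mul_inv, mul_assoc, abs_mul, abs_of_pos hμ]
        refine mul_le_mul_of_nonneg_left (le_trans ?_ hle) hμ.le
        have hnn : 0 ≤ ∫ t in u..y, t ^ (γ - 2) * Real.exp (α / t) * Fbar (y - t) :=
          intervalIntegral.integral_nonneg hyu.1.le fun t ht =>
            mul_nonneg (hwpos t (hu.1.trans_le ht.1)).le (hF_mem _ (sub_nonneg.2 ht.2)).1
        rw [abs_of_nonneg (mul_nonneg hinv.le hnn)]
        refine mul_le_mul_of_nonneg_left ?_ hinv.le
        calc ∫ t in u..y, t ^ (γ - 2) * Real.exp (α / t) * Fbar (y - t)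
            ≤ ∫ t in u..y, t ^ (γ - 2) * Real.exp (α / t) :=
              intervalIntegral.integral_mono_on hyu.1.le (hFint u y hu.1 hyu.1.le)
                (intervalIntegrable_rpow_mul_exp_div _ _ hu.1 hy.1) fun t ht =>
                mul_le_of_le_one_right (hwpos t (hu.1.trans_le ht.1)).le
                  (hF_mem _ (sub_nonneg.2 ht.2)).2
          _ ≤ ∫ t in u..u₀, t ^ (γ - 2) * Real.exp (α / t) := by
              rw [← intervalIntegral.integral_add_adjacent_intervals
                (intervalIntegrable_rpow_mul_exp_div (γ - 2) α hu.1 hy.1)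
                (intervalIntegrable_rpow_mul_exp_div (γ - 2) α hy.1 hu₀)]
              exact le_add_of_nonneg_right (intervalIntegral.integral_nonneg hy.2 fun t ht =>
                (hwpos t (hy.1.trans_le ht.1)).le)
      · rw [indicator_of_notMem hyu, norm_zero]
        positivity
    · exact integrable_const _
    · filter_upwards [ae_restrict_mem measurableSet_Ioc] with y hy
      have h := ((hKlim y hy.1).const_mul μ).mul_const (g y)
      rw [show μ * (leftLim Fbar y / α) * g y = μ / α * (g y * leftLim Fbar y) by ring] at h
      refine h.congr' ?_
      filter_upwards [Ioo_mem_nhdsGT hy.1] with u hu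
      rw [indicator_of_mem (show y ∈ Ioc u u₀ from ⟨hu.2, hy.2⟩), div_eq_mul_inv μ, mul_assoc μ _ (∫ t in u..y, _)]
  rw [integral_const_mul, ← intervalIntegral.integral_of_le hu₀.le] at hKlim'
  have hsum := (hbd.add hHlim).add hKlim'
  rw [zero_add] at hsum
  refine hsum.congr' ?_
  filter_upwards [Ioc_mem_nhdsGT hu₀] with u hu
  rw [hVolterra u hu, setIntegral_indicator measurableSet_Ioc,
    inter_eq_self_of_subset_right (Ioc_subset_Ioc_left hu.1.le),
    ← intervalIntegral.integral_of_le hu.2]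
end

section
/- (Lemma 2 of the paper.) Suppose γ > 1. Then the integro-differential equation u² g'(u) + (γ u − α) g(u) = −A g(u) has on (0,∞) a unique classical solution ĝ (continuously differentiable on (0,∞)) such that u^γ ĝ(u) → 1 as u → ∞; this solution is strictly positive, bounded on every interval (0,b], and extends to a continuous function on [0,∞) with ĝ(0) = (μ/α) ∫₀^∞ ĝ(y) F̄(y−) dy, where F̄(y−) denotes the left limit of F̄ at y. -/
open MeasureTheory Set Filter Topology Function

/-- The integral operator `A g (u) = μ ∫₀^∞ g(u+z) F̄(z) dz`. -/
noncomputable def opA (μ : ℝ) (Fbar g : ℝ → ℝ) (u : ℝ) : ℝ :=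
  μ * ∫ z in Set.Ioi (0 : ℝ), g (u + z) * Fbar z

/-- `g` is a classical solution on `(0,∞)` of the integro-differential equation
`u² g'(u) + (γu - α) g(u) = -A g(u)` with `u^γ g(u) → 1` as `u → ∞`. -/
def IsSolZero (μ α γ : ℝ) (Fbar : ℝ → ℝ) (g : ℝ → ℝ) : Prop :=
  (∀ u ∈ Set.Ioi (0 : ℝ), DifferentiableAt ℝ g u) ∧
  ContinuousOn (deriv g) (Set.Ioi 0) ∧
  (∀ u ∈ Set.Ioi (0 : ℝ), u ^ 2 * deriv g u + (γ * u - α) * g u = -opA μ Fbar g u) ∧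
  Filter.Tendsto (fun u => u ^ γ * g u) Filter.atTop (nhds 1)

/-- A function with a local maximum from the right has nonpositive derivative. -/
theorem deriv_nonpos_of_eventually_le_right {f : ℝ → ℝ} {f' x : ℝ} (hf : HasDerivAt f f' x)
    (h : ∀ᶠ y in 𝓝[>] x, f y ≤ f x) : f' ≤ 0 := by
  have hs := (hasDerivWithinAt_iff_tendsto_slope' (by simp : x ∉ Ioi x)).1
    (hf.hasDerivWithinAt (s := Ioi x))
  refine le_of_tendsto hs ?_
  filter_upwards [h, self_mem_nhdsWithin] with y hy hxy
  rw [slope_def_field]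
  exact div_nonpos_of_nonpos_of_nonneg (by linarith) (sub_nonneg.2 (le_of_lt hxy))

theorem hasDerivAt_exp_div (c : ℝ) {u : ℝ} (hu : u ≠ 0) :
    HasDerivAt (fun u => Real.exp (c / u)) (Real.exp (c / u) * (-c / u ^ 2)) u := by
  have := ((hasDerivAt_inv hu).const_mul c).exp
  simp only [← div_eq_mul_inv] at this
  exact this.congr_deriv (by field_simp)

theorem hasDerivAt_rpow_mul_exp_div_mul {f : ℝ → ℝ} {f' : ℝ} (p c : ℝ) {u : ℝ} (hu : 0 < u)
    (hf : HasDerivAt f f' u) :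
    HasDerivAt (fun u => u ^ p * Real.exp (c / u) * f u)
      (u ^ p * Real.exp (c / u) * (f' + (p / u - c / u ^ 2) * f u)) u := by
  have e1 := Real.hasDerivAt_rpow_const (x := u) (p := p) (Or.inl hu.ne')
  refine ((e1.mul (hasDerivAt_exp_div c hu.ne')).mul hf).congr_deriv ?_
  rw [Real.rpow_sub_one hu.ne']
  simp only [Pi.mul_apply]
  field_simp
  ring

theorem tendsto_exp_div_atTop (c : ℝ) :
    Tendsto (fun u : ℝ => Real.exp (c / u)) atTop (𝓝 1) := by
  rw [← Real.exp_zero]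
  exact (Real.continuous_exp.tendsto _).comp
    ((tendsto_const_nhds (x := c)).div_atTop tendsto_id)

theorem exists_bound_on_Ici {g : ℝ → ℝ} {γ c a : ℝ} (hγ : 0 ≤ γ) (ha : 0 < a)
    (hg : ContinuousOn g (Ioi 0)) (hlim : Tendsto (fun u => u ^ γ * g u) atTop (𝓝 c)) :
    ∃ M, 0 ≤ M ∧ ∀ u, a ≤ u → |g u| ≤ M := by
  have h1 : ∀ᶠ u in atTop, |u ^ γ * g u| < |c| + 1 :=
    hlim.abs.eventually_lt_const (by linarith)
  obtain ⟨R, hR⟩ := eventually_atTop.1 (h1.and (eventually_ge_atTop (1 : ℝ)))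
  obtain ⟨C, hC⟩ := (isCompact_Icc (a := a) (b := R)).exists_bound_of_continuousOn
    (hg.mono fun x hx => lt_of_lt_of_le ha hx.1)
  refine ⟨max C (|c| + 1), le_max_of_le_right (by positivity), fun u hu => ?_⟩
  rcases le_total u R with h | h
  · exact (hC u ⟨hu, h⟩).trans (le_max_left _ _)
  · obtain ⟨h2, h3⟩ := hR u h
    have h4 : 1 ≤ u ^ γ := Real.one_le_rpow h3 hγ
    rw [abs_mul, abs_of_nonneg (by linarith)] at h2
    refine le_max_of_le_right ?_
    nlinarith [abs_nonneg (g u)]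

theorem integrable_shift_mul {Fbar g : ℝ → ℝ} {γ c u : ℝ} (hγ : 0 ≤ γ)
    (hF_int : IntegrableOn Fbar (Ioi 0)) (hg : ContinuousOn g (Ioi 0))
    (hlim : Tendsto (fun u => u ^ γ * g u) atTop (𝓝 c)) (hu : 0 < u) :
    IntegrableOn (fun z => g (u + z) * Fbar z) (Ioi 0) := by
  obtain ⟨M, -, hM⟩ := exists_bound_on_Ici hγ hu hg hlim
  refine Integrable.bdd_mul (c := M) hF_int ?_ ?_
  · refine ContinuousOn.aestronglyMeasurable (hg.comp (by fun_prop) fun z hz => ?_)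
      measurableSet_Ioi
    exact add_pos hu hz
  · filter_upwards [ae_restrict_mem measurableSet_Ioi] with z hz
    exact hM _ (by linarith [mem_Ioi.1 hz])

/-- Maximum principle: a solution with nonpositive limit of `u ^ γ * g u` at infinity is
nonpositive. -/
theorem nonpos_of_tendsto_nonpos {Fbar g : ℝ → ℝ} {μ α γ c : ℝ} (hμ : 0 ≤ μ) (hα : 0 < α)
    (hγ : 0 ≤ γ) (hF : ∀ y ∈ Ioi (0 : ℝ), 0 ≤ Fbar y) (hF_int : IntegrableOn Fbar (Ioi 0))
    (hd : ∀ u ∈ Ioi (0 : ℝ), DifferentiableAt ℝ g u)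
    (heq : ∀ u ∈ Ioi (0 : ℝ), u ^ 2 * deriv g u + (γ * u - α) * g u = -opA μ Fbar g u)
    (hlim : Tendsto (fun u => u ^ γ * g u) atTop (𝓝 c)) (hc : c ≤ 0) :
    ∀ u ∈ Ioi (0 : ℝ), g u ≤ 0 := by
  intro u₁ hu₁
  rw [mem_Ioi] at hu₁
  by_contra! hpos
  set m := ∫ z in Ioi (0 : ℝ), Fbar z with hm
  have hm0 : 0 ≤ m := setIntegral_nonneg measurableSet_Ioi hF
  set l := μ * m with hl
  have hl0 : 0 ≤ l := mul_nonneg hμ hm0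
  have hg : ContinuousOn g (Ioi 0) := fun u hu => (hd u hu).continuousAt.continuousWithinAt
  set φ : ℝ → ℝ := fun u => u ^ γ * Real.exp (-l / u) * g u with hφ
  have hφd : ∀ u, 0 < u → HasDerivAt φ
      (u ^ γ * Real.exp (-l / u) * (deriv g u + (γ / u + l / u ^ 2) * g u)) u := by
    intro u hu
    refine (hasDerivAt_rpow_mul_exp_div_mul γ (-l) hu (hd u hu).hasDerivAt).congr_deriv ?_
    rw [neg_div (u ^ 2) l, sub_neg_eq_add]
  have hφlim : Tendsto φ atTop (𝓝 c) := by
    have := hlim.mul (tendsto_exp_div_atTop (-l))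
    rw [mul_one] at this
    exact this.congr fun u => by simp only [hφ]; ring
  have hφ1 : 0 < φ u₁ := by simp only [hφ]; positivity
  obtain ⟨R, hR⟩ := eventually_atTop.1 (hφlim.eventually_lt_const (hc.trans_lt hφ1))
  obtain ⟨v, hv, hvmax⟩ := (isCompact_Icc (a := u₁) (b := max R u₁)).exists_isMaxOn
    ⟨u₁, le_rfl, le_max_right _ _⟩ (f := φ)
    (fun x hx => (hφd x (hu₁.trans_le hx.1)).continuousAt.continuousWithinAt)
  have hv1 : φ u₁ ≤ φ v := hvmax ⟨le_rfl, le_max_right _ _⟩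
  have hv0 : 0 < v := hu₁.trans_le hv.1
  have hmax : ∀ x, u₁ ≤ x → φ x ≤ φ v := by
    intro x hx
    rcases le_total x (max R u₁) with h | h
    · exact hvmax ⟨hx, h⟩
    · exact (hR x ((le_max_left _ _).trans h)).le.trans hv1
  have hder := deriv_nonpos_of_eventually_le_right (hφd v hv0) (by
    filter_upwards [self_mem_nhdsWithin] with y hy
    exact hmax y (hv.1.trans (le_of_lt hy)))
  have hgv : 0 < g v := by
    have : 0 < φ v := hφ1.trans_le hv1
    exact pos_of_mul_pos_right this (by positivity)
  have hder' : deriv g v + (γ / v + l / v ^ 2) * g v ≤ 0 := by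
    by_contra! h
    have : 0 < v ^ γ * Real.exp (-l / v) * (deriv g v + (γ / v + l / v ^ 2) * g v) := by
      positivity
    linarith
  have hA : opA μ Fbar g v ≤ l * g v := by
    rw [opA, hl, mul_assoc]
    refine mul_le_mul_of_nonneg_left ?_ hμ
    rw [hm, ← integral_mul_const]
    refine setIntegral_mono_on (integrable_shift_mul hγ hF_int hg hlim hv0)
      (hF_int.mul_const _) measurableSet_Ioi fun z hz => ?_
    rw [mul_comm]
    refine mul_le_mul_of_nonneg_left ?_ (hF z hz)
    rw [mem_Ioi] at hz
    rcases le_total (g (v + z)) 0 with h | h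
    · linarith
    have h1 := hmax (v + z) (by linarith [hv.1])
    have h2 : v ^ γ * Real.exp (-l / v) ≤ (v + z) ^ γ * Real.exp (-l / (v + z)) := by
      refine mul_le_mul (by gcongr; linarith) (Real.exp_le_exp.2 ?_) (by positivity) (by positivity)
      rw [neg_div, neg_div, neg_le_neg_iff]
      gcongr
      linarith
    have h3 : v ^ γ * Real.exp (-l / v) * g (v + z) ≤ v ^ γ * Real.exp (-l / v) * g v :=
      (mul_le_mul_of_nonneg_right h2 h).trans h1
    exact le_of_mul_le_mul_left h3 (by positivity)
  have h1 := heq v hv0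
  have h2 : v ^ 2 * (deriv g v + (γ / v + l / v ^ 2) * g v) ≤ 0 :=
    mul_nonpos_of_nonneg_of_nonpos (by positivity) hder'
  have h3 : v ^ 2 * (deriv g v + (γ / v + l / v ^ 2) * g v)
      = v ^ 2 * deriv g v + γ * v * g v + l * g v := by
    field_simp
    ring
  nlinarith [mul_pos hα hgv]

/-- If `u² g' = α g - r` near `0+` and `r → L`, then asymptotically `g ≤ L / α + ε`. -/
theorem eventually_le_of_singular_ode {g r : ℝ → ℝ} {α L ε : ℝ} (hα : 0 < α) (hε : 0 < ε)
    (hd : ∀ u ∈ Ioi (0 : ℝ), DifferentiableAt ℝ g u)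
    (heq : ∀ u ∈ Ioi (0 : ℝ), u ^ 2 * deriv g u = α * g u - r u)
    (hr : Tendsto r (𝓝[>] 0) (𝓝 L)) :
    ∀ᶠ u in 𝓝[>] 0, g u < L / α + ε := by
  have h1 : ∀ᶠ u in 𝓝[>] (0 : ℝ), r u < L + α * (ε / 2) :=
    hr.eventually_lt_const (by linarith [mul_pos hα (half_pos hε)])
  obtain ⟨b, hb, hbr⟩ := mem_nhdsGT_iff_exists_Ioo_subset.1 h1
  rw [mem_Ioi] at hb
  set d := b / 2 with hd2
  have hd0 : 0 < d := by positivity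
  set ψ : ℝ → ℝ := fun u => Real.exp (α / u) * (g u - L / α - ε / 2) with hψ
  have hψd : ∀ u, 0 < u → HasDerivAt ψ
      (Real.exp (α / u) / u ^ 2 * (L + α * (ε / 2) - r u)) u := by
    intro u hu
    have e3 := (hasDerivAt_exp_div α (ne_of_gt hu)).mul
      (((hd u hu).hasDerivAt.sub_const (L / α)).sub_const (ε / 2))
    refine e3.congr_deriv ?_
    have := heq u hu
    have h4 : deriv g u = (α * g u - r u) / u ^ 2 := by
      rw [← this]; field_simp
    rw [h4]
    field_simp
    ring
  have hmono : MonotoneOn ψ (Ioc 0 d) := by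
    refine monotoneOn_of_deriv_nonneg (convex_Ioc 0 d)
      (fun u hu => (hψd u hu.1).continuousAt.continuousWithinAt)
      (fun u hu => ?_) (fun u hu => ?_)
    · rw [interior_Ioc] at hu
      exact (hψd u hu.1).differentiableAt.differentiableWithinAt
    · rw [interior_Ioc] at hu
      rw [(hψd u hu.1).deriv]
      have : r u < L + α * (ε / 2) := hbr ⟨hu.1, by linarith [hu.2]⟩
      have h5 : 0 ≤ L + α * (ε / 2) - r u := by linarith
      positivity
  have hexp : Tendsto (fun u : ℝ => Real.exp (-(α / u)) * ψ d) (𝓝[>] 0) (𝓝 0) := by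
    have h2 : Tendsto (fun u : ℝ => α / u) (𝓝[>] 0) atTop :=
      (tendsto_inv_nhdsGT_zero (𝕜 := ℝ)).const_mul_atTop hα
    have := (Real.tendsto_exp_neg_atTop_nhds_zero.comp h2).mul_const (ψ d)
    simpa using this
  filter_upwards [hexp.eventually_lt_const (half_pos hε), Ioc_mem_nhdsGT hd0] with u h3 hu
  have h4 := hmono hu ⟨hd0, le_rfl⟩ hu.2
  have h5 : g u - L / α - ε / 2 = Real.exp (-(α / u)) * ψ u := by
    simp only [hψ]
    rw [← mul_assoc, ← Real.exp_add]
    simp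
  have h6 := mul_le_mul_of_nonneg_left h4 (Real.exp_pos (-(α / u))).le
  linarith

theorem tendsto_of_singular_ode {g r : ℝ → ℝ} {α L : ℝ} (hα : 0 < α)
    (hd : ∀ u ∈ Ioi (0 : ℝ), DifferentiableAt ℝ g u)
    (heq : ∀ u ∈ Ioi (0 : ℝ), u ^ 2 * deriv g u = α * g u - r u)
    (hr : Tendsto r (𝓝[>] 0) (𝓝 L)) :
    Tendsto g (𝓝[>] 0) (𝓝 (L / α)) := by
  rw [Metric.tendsto_nhds]
  intro ε hε
  have h2 := eventually_le_of_singular_ode (g := fun u => -g u) (r := fun u => -r u) hα hε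
    (fun u hu => (hd u hu).neg) (fun u hu => by rw [deriv.fun_neg]; linarith [heq u hu]) hr.neg
  filter_upwards [eventually_le_of_singular_ode hα hε hd heq hr, h2] with u h1 h2
  rw [Real.dist_eq, abs_lt]
  rw [neg_div] at h2
  constructor <;> linarith

theorem ae_leftLim_eq_of_antitoneOn {F : ℝ → ℝ} (hF : AntitoneOn F (Ici 0)) :
    ∀ᵐ y ∂(volume.restrict (Ioi (0 : ℝ))), leftLim F y = F y := by
  have hanti : Antitone fun y => F (max y 0) := fun x y h =>
    hF (mem_Ici.2 (le_max_right _ _)) (mem_Ici.2 (le_max_right _ _)) (max_le_max_right _ h)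
  filter_upwards [ae_restrict_of_ae (hanti.countable_not_continuousAt.ae_notMem volume),
    ae_restrict_mem measurableSet_Ioi] with y hy hy0
  rw [mem_Ioi] at hy0
  have h1 : ContinuousAt (fun y => F (max y 0)) y := by simpa using hy
  have h2 : ContinuousAt F y := h1.congr <| by
    filter_upwards [Ioi_mem_nhds hy0] with x hx
    rw [max_eq_left (le_of_lt hx)]
  exact h2.continuousWithinAt.leftLim_eq

open scoped BoundedContinuousFunction NNReal

theorem abs_integral_exp_mul_le {κ C t : ℝ} {q : ℝ → ℝ} (hκ : 0 < κ) (ht : 0 ≤ t) (hC : 0 ≤ C)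
    (hq : ∀ s, |q s| ≤ C) :
    Real.exp (-(κ * t)) * |∫ s in (0 : ℝ)..t, Real.exp (κ * s) * q s| ≤ C / κ := by
  have h1 : |∫ s in (0 : ℝ)..t, Real.exp (κ * s) * q s|
      ≤ ∫ s in (0 : ℝ)..t, C * Real.exp (κ * s) := by
    rw [← Real.norm_eq_abs]
    refine intervalIntegral.norm_integral_le_of_norm_le ht (ae_of_all _ fun s _ => ?_)
      ((by fun_prop : Continuous fun s => C * Real.exp (κ * s)).intervalIntegrable
        (μ := volume) _ _)
    rw [Real.norm_eq_abs, abs_mul, Real.abs_exp, mul_comm]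
    exact mul_le_mul_of_nonneg_right (hq s) (Real.exp_pos _).le
  have h2 : ∫ s in (0 : ℝ)..t, C * Real.exp (κ * s) = C / κ * (Real.exp (κ * t) - 1) := by
    have : ∀ s ∈ uIcc 0 t, HasDerivAt (fun s => C / κ * Real.exp (κ * s))
        (C * Real.exp (κ * s)) s := fun s _ => by
      refine ((((hasDerivAt_id s).const_mul κ).exp).const_mul (C / κ)).congr_deriv ?_
      simp only [id]
      field_simp
    rw [intervalIntegral.integral_eq_sub_of_hasDerivAt this
      ((by fun_prop : Continuous fun s => C * Real.exp (κ * s)).intervalIntegrable _ _)]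
    simp only [mul_zero, Real.exp_zero]
    ring
  rw [h2] at h1
  have h3 : Real.exp (-(κ * t)) * Real.exp (κ * t) = 1 := by rw [← Real.exp_add]; simp
  have h4 := mul_le_mul_of_nonneg_left h1 (Real.exp_pos (-(κ * t))).le
  have h5 : 0 ≤ C / κ * Real.exp (-(κ * t)) := by positivity
  calc _ ≤ _ := h4
    _ = C / κ * (Real.exp (-(κ * t)) * Real.exp (κ * t)) - C / κ * Real.exp (-(κ * t)) := by ring
    _ ≤ C / κ := by rw [h3]; linarith

/-- The solution of `y' = -κ y + q`, `y 0 = 1` on `[0, ∞)`, extended to an even function. -/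
noncomputable def expVolterra (κ : ℝ) (hκ : 0 < κ) (q : ℝ →ᵇ ℝ) : ℝ →ᵇ ℝ :=
  BoundedContinuousFunction.ofNormedAddCommGroup
    (fun t => Real.exp (-(κ * |t|)) * (1 + ∫ s in (0 : ℝ)..|t|, Real.exp (κ * s) * q s))
    (by
      have : Continuous fun t => ∫ s in (0 : ℝ)..t, Real.exp (κ * s) * q s :=
        intervalIntegral.continuous_primitive
          (fun a b => Continuous.intervalIntegrable (by fun_prop) a b) 0
      have := this.comp continuous_abs
      simp only [Function.comp_def] at this
      fun_prop)
    (1 + ‖q‖ / κ)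
    (fun t => by
      have h1 := abs_integral_exp_mul_le hκ (abs_nonneg t) (norm_nonneg q) q.norm_coe_le_norm
      have h2 : Real.exp (-(κ * |t|)) ≤ 1 := Real.exp_le_one_iff.2 (by
        have := mul_nonneg hκ.le (abs_nonneg t); linarith)
      rw [Real.norm_eq_abs, abs_mul, Real.abs_exp]
      refine (mul_le_mul_of_nonneg_left (abs_add_le _ _) (Real.exp_pos _).le).trans ?_
      rw [mul_add, abs_one, mul_one]
      exact add_le_add h2 h1)

theorem expVolterra_apply (κ : ℝ) (hκ : 0 < κ) (q : ℝ →ᵇ ℝ) (t : ℝ) :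
    expVolterra κ hκ q t
      = Real.exp (-(κ * |t|)) * (1 + ∫ s in (0 : ℝ)..|t|, Real.exp (κ * s) * q s) := rfl

theorem dist_expVolterra_le {κ : ℝ} (hκ : 0 < κ) (q₁ q₂ : ℝ →ᵇ ℝ) :
    dist (expVolterra κ hκ q₁) (expVolterra κ hκ q₂) ≤ dist q₁ q₂ / κ := by
  refine (BoundedContinuousFunction.dist_le (by positivity)).2 fun t => ?_
  rw [expVolterra_apply, expVolterra_apply, Real.dist_eq, ← mul_sub, add_sub_add_left_eq_sub,
    ← intervalIntegral.integral_sub (Continuous.intervalIntegrable (by fun_prop) _ _)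
      (Continuous.intervalIntegrable (by fun_prop) _ _), abs_mul, Real.abs_exp]
  simp only [← mul_sub]
  refine abs_integral_exp_mul_le hκ (abs_nonneg t) dist_nonneg fun s => ?_
  rw [← Real.dist_eq]
  exact BoundedContinuousFunction.dist_coe_le_dist s

theorem hasDerivAt_expVolterra {κ : ℝ} (hκ : 0 < κ) (q : ℝ →ᵇ ℝ) {t : ℝ} (ht : 0 < t) :
    HasDerivAt (expVolterra κ hκ q) (-κ * expVolterra κ hκ q t + q t) t := by
  have hc : Continuous fun s => Real.exp (κ * s) * q s := by fun_prop
  have h1 : HasDerivAt (fun t => ∫ s in (0 : ℝ)..t, Real.exp (κ * s) * q s)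
      (Real.exp (κ * t) * q t) t := hc.integral_hasStrictDerivAt 0 t |>.hasDerivAt
  have h2 : HasDerivAt (fun t => Real.exp (-(κ * t))) (Real.exp (-(κ * t)) * -κ) t := by
    refine (((hasDerivAt_id t).const_mul κ).neg.exp).congr_deriv ?_
    simp
  have h3 := h2.mul (h1.const_add 1)
  have h4 : Real.exp (-(κ * t)) * Real.exp (κ * t) = 1 := by rw [← Real.exp_add]; simp
  refine (h3.congr_deriv ?_).congr_of_eventuallyEq ?_
  · rw [expVolterra_apply, abs_of_pos ht, ← mul_assoc, h4]
    ring
  · filter_upwards [Ioi_mem_nhds ht] with s hs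
    rw [expVolterra_apply, abs_of_pos hs, Pi.mul_apply]

/-- A causal-type equation `y' = -κ y + P y` with small Lipschitz perturbation `P` has a bounded
solution with `y 0 = 1`. -/
theorem exists_bounded_solution {P : (ℝ →ᵇ ℝ) → (ℝ →ᵇ ℝ)} {K κ : ℝ} (hK : 0 ≤ K) (hκ : K < κ)
    (hP : ∀ y₁ y₂, dist (P y₁) (P y₂) ≤ K * dist y₁ y₂) :
    ∃ y : ℝ →ᵇ ℝ, y 0 = 1 ∧ ∀ t, 0 < t → HasDerivAt y (-κ * y t + P y t) t := by
  have hκ0 : 0 < κ := hK.trans_lt hκ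
  have hcontr : ContractingWith (K / κ).toNNReal fun y => expVolterra κ hκ0 (P y) := by
    refine ⟨?_, LipschitzWith.of_dist_le_mul fun y₁ y₂ => ?_⟩
    · rw [Real.toNNReal_lt_one]
      exact (div_lt_one hκ0).2 hκ
    · refine (dist_expVolterra_le hκ0 _ _).trans ?_
      rw [Real.coe_toNNReal _ (by positivity), div_mul_eq_mul_div]
      gcongr
      exact hP _ _
  have hfix := hcontr.fixedPoint_isFixedPt
  set y := hcontr.fixedPoint with hy
  have hfix' : expVolterra κ hκ0 (P y) = y := hfix
  refine ⟨y, ?_, fun t ht => ?_⟩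
  · rw [← hfix', expVolterra_apply]
    simp
  · have := hasDerivAt_expVolterra hκ0 (P y) ht
    rwa [hfix'] at this

/-- The kernel of `opA` after the substitution `u = 1 / s` and weighting. -/
noncomputable def invKernel (γ l s z : ℝ) : ℝ :=
  (1 + |s| * z) ^ (-γ) * Real.exp (-(l * (|s| - |s| / (1 + |s| * z))))

theorem continuous_invKernel {γ l z : ℝ} (hz : 0 ≤ z) : Continuous fun s => invKernel γ l s z := by
  have h : ∀ s : ℝ, 1 + |s| * z ≠ 0 := fun s => by positivity
  unfold invKernel
  exact (Continuous.rpow_const (by fun_prop) fun s => Or.inl (h s)).mul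
    (by fun_prop (disch := simp [h]))

theorem continuousOn_invKernel {γ l s : ℝ} : ContinuousOn (fun z => invKernel γ l s z) (Ioi 0) := by
  have h : ∀ z ∈ Ioi (0 : ℝ), 1 + |s| * z ≠ 0 := fun z hz => by
    rw [mem_Ioi] at hz
    positivity
  unfold invKernel
  refine (ContinuousOn.rpow_const (by fun_prop) fun z hz => Or.inl (h z hz)).mul ?_
  fun_prop (disch := exact h)

theorem abs_invKernel_le_one {γ l s z : ℝ} (hγ : 0 ≤ γ) (hl : 0 ≤ l) (hz : 0 ≤ z) :
    |invKernel γ l s z| ≤ 1 := by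
  have h1 : 1 ≤ 1 + |s| * z := by
    have := mul_nonneg (abs_nonneg s) hz
    linarith
  have h2 : |s| / (1 + |s| * z) ≤ |s| := div_le_self (abs_nonneg s) h1
  rw [invKernel, abs_of_nonneg (by positivity)]
  refine mul_le_one₀ (Real.rpow_le_one_of_one_le_of_nonpos h1 (by linarith)) (Real.exp_pos _).le
    (Real.exp_le_one_iff.2 ?_)
  have := mul_nonneg hl (sub_nonneg.2 h2)
  linarith

section InvOp

variable {Fbar : ℝ → ℝ} {γ l : ℝ}

theorem norm_invKernel_mul_le (hγ : 0 ≤ γ) (hl : 0 ≤ l) (hF : ∀ y ∈ Ioi (0 : ℝ), 0 ≤ Fbar y)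
    (y : ℝ →ᵇ ℝ) (s : ℝ) {z : ℝ} (hz : z ∈ Ioi (0 : ℝ)) :
    ‖invKernel γ l s z * y (|s| / (1 + |s| * z)) * Fbar z‖ ≤ ‖y‖ * Fbar z := by
  rw [norm_mul, norm_mul, Real.norm_of_nonneg (hF z hz)]
  refine mul_le_mul_of_nonneg_right ?_ (hF z hz)
  exact (mul_le_mul (abs_invKernel_le_one hγ hl (le_of_lt hz)) (y.norm_coe_le_norm _)
    (norm_nonneg _) zero_le_one).trans_eq (one_mul _)

theorem aestronglyMeasurable_invKernel_mul (hF_int : IntegrableOn Fbar (Ioi 0))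
    (y : ℝ →ᵇ ℝ) (s : ℝ) :
    AEStronglyMeasurable (fun z => invKernel γ l s z * y (|s| / (1 + |s| * z)) * Fbar z)
      (volume.restrict (Ioi 0)) := by
  refine (ContinuousOn.aestronglyMeasurable ?_ measurableSet_Ioi).mul hF_int.1
  have h : ∀ z ∈ Ioi (0 : ℝ), 1 + |s| * z ≠ 0 := fun z hz => by
    rw [mem_Ioi] at hz
    positivity
  refine continuousOn_invKernel.mul (y.continuous.comp_continuousOn ?_)
  fun_prop (disch := exact h)

theorem integrable_invKernel_mul (hγ : 0 ≤ γ) (hl : 0 ≤ l) (hF : ∀ y ∈ Ioi (0 : ℝ), 0 ≤ Fbar y)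
    (hF_int : IntegrableOn Fbar (Ioi 0)) (y : ℝ →ᵇ ℝ) (s : ℝ) :
    IntegrableOn (fun z => invKernel γ l s z * y (|s| / (1 + |s| * z)) * Fbar z) (Ioi 0) := by
  refine (hF_int.const_mul ‖y‖).mono' (aestronglyMeasurable_invKernel_mul hF_int y s) ?_
  filter_upwards [ae_restrict_mem measurableSet_Ioi] with z hz
  exact norm_invKernel_mul_le hγ hl hF y s hz

/-- The operator `opA` after the substitution `u = 1 / s` and weighting, acting on bounded
continuous functions. -/
noncomputable def invOp (μ : ℝ) (hγ : 0 ≤ γ) (hl : 0 ≤ l) (hF : ∀ y ∈ Ioi (0 : ℝ), 0 ≤ Fbar y)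
    (hF_int : IntegrableOn Fbar (Ioi 0)) (y : ℝ →ᵇ ℝ) : ℝ →ᵇ ℝ :=
  BoundedContinuousFunction.ofNormedAddCommGroup
    (fun s => μ * ∫ z in Ioi (0 : ℝ), invKernel γ l s z * y (|s| / (1 + |s| * z)) * Fbar z)
    (by
      refine continuous_const.mul (continuous_of_dominated
        (aestronglyMeasurable_invKernel_mul hF_int y)
        (fun s => ?_) (hF_int.const_mul ‖y‖) ?_)
      · filter_upwards [ae_restrict_mem measurableSet_Ioi] with z hz
        exact norm_invKernel_mul_le hγ hl hF y s hz
      · filter_upwards [ae_restrict_mem measurableSet_Ioi] with z hz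
        rw [mem_Ioi] at hz
        have h : ∀ s : ℝ, 1 + |s| * z ≠ 0 := fun s => by positivity
        refine ((continuous_invKernel hz.le).mul (y.continuous.comp ?_)).mul continuous_const
        fun_prop (disch := simp [h]))
    (|μ| * ∫ z in Ioi (0 : ℝ), ‖y‖ * Fbar z)
    (fun s => by
      rw [norm_mul, Real.norm_eq_abs]
      refine mul_le_mul_of_nonneg_left (norm_integral_le_of_norm_le (hF_int.const_mul ‖y‖) ?_)
        (abs_nonneg μ)
      filter_upwards [ae_restrict_mem measurableSet_Ioi] with z hz
      exact norm_invKernel_mul_le hγ hl hF y s hz)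

variable (μ : ℝ) (hγ : 0 ≤ γ) (hl : 0 ≤ l) (hF : ∀ y ∈ Ioi (0 : ℝ), 0 ≤ Fbar y)
  (hF_int : IntegrableOn Fbar (Ioi 0))

theorem invOp_apply (y : ℝ →ᵇ ℝ) (s : ℝ) :
    invOp μ hγ hl hF hF_int y s
      = μ * ∫ z in Ioi (0 : ℝ), invKernel γ l s z * y (|s| / (1 + |s| * z)) * Fbar z := rfl

theorem dist_invOp_le (hμ : 0 ≤ μ) (y₁ y₂ : ℝ →ᵇ ℝ) :
    dist (invOp μ hγ hl hF hF_int y₁) (invOp μ hγ hl hF hF_int y₂)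
      ≤ (μ * ∫ z in Ioi (0 : ℝ), Fbar z) * dist y₁ y₂ := by
  have hm0 : 0 ≤ ∫ z in Ioi (0 : ℝ), Fbar z := setIntegral_nonneg measurableSet_Ioi hF
  refine (BoundedContinuousFunction.dist_le (by positivity)).2 fun s => ?_
  rw [invOp_apply, invOp_apply, Real.dist_eq, ← mul_sub,
    ← integral_sub (integrable_invKernel_mul hγ hl hF hF_int y₁ s)
      (integrable_invKernel_mul hγ hl hF hF_int y₂ s), abs_mul, abs_of_nonneg hμ, mul_assoc]
  refine mul_le_mul_of_nonneg_left ?_ hμ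
  rw [mul_comm, ← integral_const_mul, dist_eq_norm, ← Real.norm_eq_abs]
  refine norm_integral_le_of_norm_le (hF_int.const_mul _) ?_
  filter_upwards [ae_restrict_mem measurableSet_Ioi] with z hz
  have := norm_invKernel_mul_le hγ hl hF (y₁ - y₂) s hz
  rwa [BoundedContinuousFunction.sub_apply, mul_sub, sub_mul] at this

/-- Conjugating `invOp` back to the variable `u = 1 / s` gives `opA`. -/
theorem opA_eq_invOp (y : ℝ →ᵇ ℝ) {u : ℝ} (hu : 0 < u) :
    opA μ Fbar (fun u => u ^ (-γ) * Real.exp (l / u) * y u⁻¹) u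
      = u ^ (-γ) * Real.exp (l / u) * invOp μ hγ hl hF hF_int y u⁻¹ := by
  rw [opA, invOp_apply, mul_left_comm,
    ← integral_const_mul (u ^ (-γ) * Real.exp (l / u))]
  congr 1
  refine setIntegral_congr_fun measurableSet_Ioi fun z hz => ?_
  rw [mem_Ioi] at hz
  have hk : |u⁻¹| / (1 + |u⁻¹| * z) = (u + z)⁻¹ := by
    rw [abs_of_pos (by positivity)]
    field_simp
  have h1 : u + z = u * (1 + |u⁻¹| * z) := by
    rw [abs_of_pos (by positivity)]
    field_simp
  have h2 : l / (u + z) = l / u + -(l * (|u⁻¹| - (u + z)⁻¹)) := by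
    rw [abs_of_pos (by positivity)]
    field_simp
    ring
  have h3 : (u + z) ^ (-γ) = u ^ (-γ) * (1 + |u⁻¹| * z) ^ (-γ) := by
    rw [← Real.mul_rpow hu.le (by positivity), ← h1]
  simp only [invKernel]
  rw [hk, h2, Real.exp_add, h3]
  ring

end InvOp

theorem exists_isSolZero {Fbar : ℝ → ℝ} {μ α γ : ℝ} (hμ : 0 ≤ μ) (hα : 0 < α) (hγ : 0 ≤ γ)
    (hF : ∀ y ∈ Ioi (0 : ℝ), 0 ≤ Fbar y) (hF_int : IntegrableOn Fbar (Ioi 0)) :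
    ∃ g, IsSolZero μ α γ Fbar g := by
  have hm0 : 0 ≤ ∫ z in Ioi (0 : ℝ), Fbar z := setIntegral_nonneg measurableSet_Ioi hF
  obtain ⟨l, hl⟩ : ∃ l, l = μ * ∫ z in Ioi (0 : ℝ), Fbar z := ⟨_, rfl⟩
  have hl0 : 0 ≤ l := hl ▸ mul_nonneg hμ hm0
  obtain ⟨y, hy0, hy⟩ := exists_bounded_solution (P := invOp μ hγ hl0 hF hF_int) (K := l)
    (κ := l + α) hl0 (by linarith) (fun y₁ y₂ => hl ▸ dist_invOp_le μ hγ hl0 hF hF_int hμ y₁ y₂)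
  set g : ℝ → ℝ := fun u => u ^ (-γ) * Real.exp (l / u) * y u⁻¹ with hg
  have hA : ∀ u, 0 < u → opA μ Fbar g u
      = u ^ (-γ) * Real.exp (l / u) * invOp μ hγ hl0 hF hF_int y u⁻¹ := fun u hu =>
    opA_eq_invOp μ hγ hl0 hF hF_int y hu
  have hd : ∀ u, 0 < u → HasDerivAt g (((α - γ * u) * g u - opA μ Fbar g u) / u ^ 2) u := by
    intro u hu
    have h1 := (hy u⁻¹ (inv_pos.2 hu)).comp u (hasDerivAt_inv hu.ne')
    refine (hasDerivAt_rpow_mul_exp_div_mul (-γ) l hu h1).congr_deriv ?_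
    rw [hA u hu]
    simp only [hg, Function.comp_apply]
    field_simp
    ring
  have hgc : ContinuousOn g (Ioi 0) := fun u hu => (hd u hu).continuousAt.continuousWithinAt
  have hrpow : ContinuousOn (fun u : ℝ => u ^ (-γ) * Real.exp (l / u)) (Ioi 0) := by
    intro u hu
    exact ((Real.continuousAt_rpow_const u (-γ) (Or.inl (ne_of_gt hu))).mul
      (hasDerivAt_exp_div l (ne_of_gt hu)).continuousAt).continuousWithinAt
  have hAc : ContinuousOn (opA μ Fbar g) (Ioi 0) := by
    refine ContinuousOn.congr (hrpow.mul ((invOp μ hγ hl0 hF hF_int y).continuous.comp_continuousOn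
      (continuousOn_inv₀.mono fun u hu => ne_of_gt hu))) fun u hu => hA u hu
  refine ⟨g, fun u hu => (hd u hu).differentiableAt, ?_, fun u hu => ?_, ?_⟩
  · have : ContinuousOn (fun u => ((α - γ * u) * g u - opA μ Fbar g u) / u ^ 2) (Ioi 0) :=
      (((by fun_prop : ContinuousOn (fun u => α - γ * u) (Ioi 0)).mul hgc).sub hAc).div
        (by fun_prop) fun u hu => pow_ne_zero 2 (ne_of_gt hu)
    exact this.congr fun u hu => (hd u hu).deriv
  · rw [mem_Ioi] at hu
    rw [(hd u hu).deriv]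
    field_simp
    ring
  · have h1 : Tendsto (fun u : ℝ => y u⁻¹) atTop (𝓝 1) := by
      rw [← hy0]
      exact (y.continuous.tendsto 0).comp tendsto_inv_atTop_zero
    have h2 := (tendsto_exp_div_atTop l).mul h1
    rw [mul_one] at h2
    refine h2.congr' ?_
    filter_upwards [eventually_gt_atTop 0] with u hu
    simp only [hg]
    rw [← mul_assoc, ← mul_assoc, ← Real.rpow_add hu]
    simp

theorem IsSolZero.le {Fbar g h : ℝ → ℝ} {μ α γ : ℝ} (hμ : 0 ≤ μ) (hα : 0 < α) (hγ : 0 ≤ γ)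
    (hF : ∀ y ∈ Ioi (0 : ℝ), 0 ≤ Fbar y) (hF_int : IntegrableOn Fbar (Ioi 0))
    (hg : IsSolZero μ α γ Fbar g) (hh : IsSolZero μ α γ Fbar h) {u : ℝ} (hu : u ∈ Ioi (0 : ℝ)) :
    g u ≤ h u := by
  obtain ⟨hg1, -, hg2, hg3⟩ := hg
  obtain ⟨hh1, -, hh2, hh3⟩ := hh
  have hgc : ContinuousOn g (Ioi 0) := fun u hu => (hg1 u hu).continuousAt.continuousWithinAt
  have hhc : ContinuousOn h (Ioi 0) := fun u hu => (hh1 u hu).continuousAt.continuousWithinAt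
  refine sub_nonpos.1 (nonpos_of_tendsto_nonpos (g := fun u => g u - h u) (c := 1 - 1) hμ hα hγ hF
    hF_int (fun v hv => (hg1 v hv).sub (hh1 v hv)) (fun v hv => ?_) ?_ (by simp) u hu)
  · have hA : opA μ Fbar (fun u => g u - h u) v = opA μ Fbar g v - opA μ Fbar h v := by
      simp only [opA, sub_mul]
      rw [integral_sub (integrable_shift_mul hγ hF_int hgc hg3 hv)
        (integrable_shift_mul hγ hF_int hhc hh3 hv), mul_sub]
    rw [deriv_fun_sub (hg1 v hv) (hh1 v hv), hA]
    linarith [hg2 v hv, hh2 v hv]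
  · simpa only [mul_sub] using hg3.sub hh3

theorem IsSolZero.pos {Fbar g : ℝ → ℝ} {μ α γ : ℝ} (hμ : 0 ≤ μ) (hα : 0 < α) (hγ : 0 ≤ γ)
    (hF : ∀ y ∈ Ioi (0 : ℝ), 0 ≤ Fbar y) (hF_int : IntegrableOn Fbar (Ioi 0))
    (hg : IsSolZero μ α γ Fbar g) {u : ℝ} (hu : u ∈ Ioi (0 : ℝ)) : 0 < g u := by
  obtain ⟨hg1, -, hg2, hg3⟩ := hg
  have hnonneg : ∀ v ∈ Ioi (0 : ℝ), 0 ≤ g v := by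
    intro v hv
    refine neg_nonpos.1 (nonpos_of_tendsto_nonpos (g := fun u => -g u) (c := -1) hμ hα hγ hF
      hF_int (fun v hv => (hg1 v hv).neg) (fun v hv => ?_) ?_ (by simp) v hv)
    · have hA : opA μ Fbar (fun u => -g u) v = -opA μ Fbar g v := by
        simp only [opA, neg_mul, integral_neg, mul_neg]
      rw [deriv.fun_neg, hA]
      linarith [hg2 v hv]
    · simpa only [mul_neg] using hg3.neg
  set φ : ℝ → ℝ := fun u => u ^ γ * Real.exp (α / u) * g u with hφ
  have hφd : ∀ v, 0 < v → HasDerivAt φ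
      (v ^ γ * Real.exp (α / v) * (deriv g v + (γ / v - α / v ^ 2) * g v)) v := fun v hv =>
    hasDerivAt_rpow_mul_exp_div_mul γ α hv (hg1 v hv).hasDerivAt
  have hanti : AntitoneOn φ (Ioi 0) := by
    refine antitoneOn_of_deriv_nonpos (convex_Ioi 0)
      (fun v hv => (hφd v hv).continuousAt.continuousWithinAt)
      (fun v hv => ?_) (fun v hv => ?_)
    · rw [interior_Ioi] at hv
      exact (hφd v hv).differentiableAt.differentiableWithinAt
    · rw [interior_Ioi, mem_Ioi] at hv
      rw [(hφd v hv).deriv]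
      refine mul_nonpos_of_nonneg_of_nonpos (by positivity) ?_
      have hA : 0 ≤ opA μ Fbar g v := mul_nonneg hμ <|
        setIntegral_nonneg measurableSet_Ioi fun z hz =>
          mul_nonneg (hnonneg _ (add_pos hv hz)) (hF z hz)
      have h1 : deriv g v + (γ / v - α / v ^ 2) * g v = -opA μ Fbar g v / v ^ 2 := by
        rw [← hg2 v hv]
        field_simp
      rw [h1]
      exact div_nonpos_of_nonpos_of_nonneg (by linarith) (by positivity)
  have hlim : Tendsto φ atTop (𝓝 1) := by
    have := hg3.mul (tendsto_exp_div_atTop α)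
    rw [mul_one] at this
    exact this.congr fun v => by simp only [hφ]; ring
  rw [mem_Ioi] at hu
  have h1 : 1 ≤ φ u := by
    refine le_of_tendsto hlim ?_
    filter_upwards [eventually_ge_atTop u] with v hv
    exact hanti hu (hu.trans_le hv) hv
  exact pos_of_mul_pos_right (zero_lt_one.trans_le h1) (by positivity)

theorem IsSolZero.exists_bound {Fbar g : ℝ → ℝ} {μ α γ : ℝ} (hμ : 0 < μ) (hα : 0 < α) (hγ : 0 ≤ γ)
    (hF : ∀ y ∈ Ioi (0 : ℝ), 0 ≤ Fbar y) (hF1 : ∀ y ∈ Ioi (0 : ℝ), Fbar y ≤ 1)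
    (hF_int : IntegrableOn Fbar (Ioi 0)) (hg : IsSolZero μ α γ Fbar g) :
    ∃ B, ∀ u ∈ Ioi (0 : ℝ), |g u| ≤ B := by
  have hpos : ∀ u ∈ Ioi (0 : ℝ), 0 < g u := fun u hu => hg.pos hμ.le hα hγ hF hF_int hu
  obtain ⟨hg1, -, hg2, hg3⟩ := hg
  have hgc : ContinuousOn g (Ioi 0) := fun u hu => (hg1 u hu).continuousAt.continuousWithinAt
  set m := ∫ z in Ioi (0 : ℝ), Fbar z with hm
  set δ := α / (2 * (μ + γ)) with hδ
  have hδ0 : 0 < δ := by positivity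
  have hδ1 : (μ + γ) * δ = α / 2 := by
    rw [hδ]
    field_simp
  obtain ⟨M, hM0, hM⟩ := exists_bound_on_Ici hγ hδ0 hgc hg3
  refine ⟨max M (2 * μ * M * m / α), fun u hu => ?_⟩
  rw [mem_Ioi] at hu
  rcases le_total δ u with h | h
  · exact le_max_of_le_left (hM u h)
  obtain ⟨v, hv, hvmax⟩ := (isCompact_Icc (a := u) (b := δ)).exists_isMaxOn ⟨u, le_rfl, h⟩
    (hgc.mono fun x hx => hu.trans_le hx.1)
  rw [abs_of_pos (hpos u hu)]
  refine (hvmax ⟨le_rfl, h⟩ : g u ≤ g v).trans ?_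
  rcases hv.2.eq_or_lt with hvδ | hvδ
  · exact le_max_of_le_left ((le_abs_self _).trans (hM v hvδ.ge))
  refine le_max_of_le_right ?_
  have hv0 : 0 < v := hu.trans_le hv.1
  have hder := deriv_nonpos_of_eventually_le_right (hg1 v hv0).hasDerivAt (by
    filter_upwards [Ioc_mem_nhdsGT hvδ] with y hy
    exact hvmax ⟨hv.1.trans hy.1.le, hy.2⟩)
  have hind : IntegrableOn (fun z => (Ioc 0 δ).indicator (fun _ => g v) z) (Ioi 0) := by
    refine Integrable.integrableOn ?_
    rw [integrable_indicator_iff measurableSet_Ioc]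
    exact integrableOn_const (by simp)
  have hA : opA μ Fbar g v ≤ μ * (δ * g v + M * m) := by
    refine mul_le_mul_of_nonneg_left ?_ hμ.le
    have hI : ∫ z in Ioi (0 : ℝ), ((Ioc 0 δ).indicator (fun _ => g v) z + M * Fbar z)
        = δ * g v + M * m := by
      rw [integral_add hind (hF_int.const_mul M), integral_const_mul,
        setIntegral_indicator measurableSet_Ioc, inter_eq_self_of_subset_right Ioc_subset_Ioi_self,
        setIntegral_const]
      simp [hδ0.le, hm]
    rw [← hI]
    refine setIntegral_mono_on (integrable_shift_mul hγ hF_int hgc hg3 hv0)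
      (hind.add (hF_int.const_mul M)) measurableSet_Ioi fun z hz => ?_
    rw [mem_Ioi] at hz
    have hFz := hF z hz
    have hFz1 := hF1 z hz
    have hgv := hpos v hv0
    rcases le_total (v + z) δ with h | h
    · have h1 : g (v + z) ≤ g v := hvmax ⟨by linarith [hv.1], h⟩
      have h2 := hpos (v + z) (add_pos hv0 hz)
      rw [indicator_of_mem (show z ∈ Ioc 0 δ from ⟨hz, by linarith⟩)]
      nlinarith [mul_nonneg hM0 hFz]
    · have h1 := mul_le_mul_of_nonneg_right ((le_abs_self _).trans (hM (v + z) h)) hFz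
      have h2 : 0 ≤ (Ioc 0 δ).indicator (fun _ => g v) z := indicator_nonneg (fun _ _ => hgv.le) z
      linarith
  have h1 := hg2 v hv0
  have h2 : v ^ 2 * deriv g v ≤ 0 := mul_nonpos_of_nonneg_of_nonpos (by positivity) hder
  have h3 : γ * v * g v ≤ γ * δ * g v := by
    have := (hpos v hv0).le
    gcongr
  rw [le_div_iff₀ hα]
  have h4 : (μ + γ) * δ * g v = α / 2 * g v := by rw [hδ1]
  linarith

theorem tendsto_opA_zero {Fbar g : ℝ → ℝ} {μ B : ℝ} (hF : ∀ y ∈ Ioi (0 : ℝ), 0 ≤ Fbar y)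
    (hF_int : IntegrableOn Fbar (Ioi 0)) (hg : ContinuousOn g (Ioi 0))
    (hB : ∀ u ∈ Ioi (0 : ℝ), |g u| ≤ B) :
    Tendsto (opA μ Fbar g) (𝓝[>] 0) (𝓝 (μ * ∫ y in Ioi (0 : ℝ), g y * Fbar y)) := by
  refine Tendsto.const_mul μ ?_
  refine tendsto_integral_filter_of_dominated_convergence (fun z => B * Fbar z) ?_ ?_
    (hF_int.const_mul B) ?_
  · filter_upwards [self_mem_nhdsWithin] with u hu
    refine (ContinuousOn.aestronglyMeasurable (hg.comp (by fun_prop) fun z hz => ?_)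
      measurableSet_Ioi).mul hF_int.1
    exact add_pos (mem_Ioi.1 hu) (mem_Ioi.1 hz)
  · filter_upwards [self_mem_nhdsWithin] with u hu
    filter_upwards [ae_restrict_mem measurableSet_Ioi] with z hz
    rw [norm_mul, Real.norm_of_nonneg (hF z hz)]
    exact mul_le_mul_of_nonneg_right (hB _ (mem_Ioi.2 (add_pos hu hz))) (hF z hz)
  · filter_upwards [ae_restrict_mem measurableSet_Ioi] with z hz
    refine Tendsto.mul_const _ ?_
    have h1 : Tendsto (fun u : ℝ => u + z) (𝓝[>] 0) (𝓝 z) := by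
      have : Tendsto (fun u : ℝ => u + z) (𝓝 0) (𝓝 (0 + z)) :=
        (continuous_id.add continuous_const).tendsto 0
      rw [zero_add] at this
      exact this.mono_left nhdsWithin_le_nhds
    exact (hg.continuousAt (Ioi_mem_nhds hz)).tendsto.comp h1

theorem IsSolZero.tendsto_zero {Fbar g : ℝ → ℝ} {μ α γ B : ℝ} (hα : 0 < α)
    (hF : ∀ y ∈ Ioi (0 : ℝ), 0 ≤ Fbar y) (hF_int : IntegrableOn Fbar (Ioi 0))
    (hg : IsSolZero μ α γ Fbar g) (hB : ∀ u ∈ Ioi (0 : ℝ), |g u| ≤ B) :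
    Tendsto g (𝓝[>] 0) (𝓝 (μ / α * ∫ y in Ioi (0 : ℝ), g y * Fbar y)) := by
  obtain ⟨hg1, -, hg2, -⟩ := hg
  have hgc : ContinuousOn g (Ioi 0) := fun u hu => (hg1 u hu).continuousAt.continuousWithinAt
  have h1 : Tendsto (fun u => γ * u * g u) (𝓝[>] 0) (𝓝 0) := by
    have h2 : Tendsto (fun u : ℝ => γ * u) (𝓝[>] 0) (𝓝 0) := by
      have : Tendsto (fun u : ℝ => γ * u) (𝓝 0) (𝓝 (γ * 0)) :=
        (continuous_const.mul continuous_id).tendsto 0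
      rw [mul_zero] at this
      exact this.mono_left nhdsWithin_le_nhds
    refine h2.zero_mul_isBoundedUnder_le ⟨B, ?_⟩
    rw [eventually_map]
    filter_upwards [self_mem_nhdsWithin] with u hu
    exact hB u hu
  have h2 := (tendsto_opA_zero (μ := μ) hF hF_int hgc hB).add h1
  rw [add_zero] at h2
  rw [div_mul_eq_mul_div]
  exact tendsto_of_singular_ode hα hg1 (fun u hu => by linarith [hg2 u hu]) h2

theorem stmt14
    (Fbar : ℝ → ℝ) (μ α γ m : ℝ)
    (hμ : 0 < μ) (hα : 0 < α) (hγ : 1 < γ)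
    (hF_anti : AntitoneOn Fbar (Set.Ici 0))
    (hF_mem : ∀ y ∈ Set.Ici (0 : ℝ), Fbar y ∈ Set.Icc (0 : ℝ) 1)
    (hF_int : IntegrableOn Fbar (Set.Ioi 0))
    (hm : m = ∫ z in Set.Ioi (0 : ℝ), Fbar z) :
    ∃ ghat : ℝ → ℝ,
      IsSolZero μ α γ Fbar ghat ∧
      (∀ h : ℝ → ℝ, IsSolZero μ α γ Fbar h → ∀ u ∈ Set.Ioi (0 : ℝ), h u = ghat u) ∧
      (∀ u ∈ Set.Ioi (0 : ℝ), 0 < ghat u) ∧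
      (∀ b : ℝ, 0 < b → ∃ B : ℝ, ∀ u ∈ Set.Ioc (0 : ℝ) b, |ghat u| ≤ B) ∧
      Tendsto ghat (nhdsWithin 0 (Set.Ioi 0))
        (nhds (μ / α * ∫ y in Set.Ioi (0 : ℝ), ghat y * leftLim Fbar y)) := by
  have hγ0 : 0 ≤ γ := by linarith
  have hF : ∀ y ∈ Ioi (0 : ℝ), 0 ≤ Fbar y := fun y hy => (hF_mem y (Ioi_subset_Ici_self hy)).1
  have hF1 : ∀ y ∈ Ioi (0 : ℝ), Fbar y ≤ 1 := fun y hy => (hF_mem y (Ioi_subset_Ici_self hy)).2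
  obtain ⟨g, hg⟩ := exists_isSolZero hμ.le hα hγ0 hF hF_int
  obtain ⟨B, hB⟩ := hg.exists_bound hμ hα hγ0 hF hF1 hF_int
  refine ⟨g, hg, fun h hh u hu => ?_, fun u hu => hg.pos hμ.le hα hγ0 hF hF_int hu,
    fun b _ => ⟨B, fun u hu => hB u hu.1⟩, ?_⟩
  · exact le_antisymm (hh.le hμ.le hα hγ0 hF hF_int hg hu) (hg.le hμ.le hα hγ0 hF hF_int hh hu)
  · have h1 : ∫ y in Ioi (0 : ℝ), g y * leftLim Fbar y = ∫ y in Ioi (0 : ℝ), g y * Fbar y :=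
      integral_congr_ae <| by
        filter_upwards [ae_leftLim_eq_of_antitoneOn hF_anti] with y hy
        rw [hy]
    rw [h1]
    exact hg.tendsto_zero hα hF hF_int hB
end
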